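/- Every finite bipartite simple graph G with parts A and B admits a contact representation by convex polygons in ℝ³ in which every contact point p_e has integer coordinates, with first coordinate among |A| fixed consecutive integers, second coordinate among 2⌈|B|/4⌉ fixed consecutive integers, and third coordinate among ⌈|A|/2⌉² + ⌈|B|/4⌉² fixed consecutive integers (i.e., the representation lies on an integer grid of size |A| × 2⌈|B|/4⌉ × (⌈|A|/2⌉² + ⌈|B|/4⌉²)). -/

import Mathlib

/-- The half-space `f > f q`, together with the point `q`, is convex. -/
lemma convex_setOf_lt_or_eq {E : Type*} [AddCommGroup E] [Module ℝ E] (f : E →ₗ[ℝ] ℝ) (q : E)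
    (P : Prop) : Convex ℝ {x | f q < f x ∨ (x = q ∧ P)} := by
  rintro x hx y hy α β hα hβ hαβ
  obtain rfl | hα' := hα.eq_or_lt
  · obtain rfl : β = 1 := by linarith
    simpa using hy
  obtain rfl | hβ' := hβ.eq_or_lt
  · obtain rfl : α = 1 := by linarith
    simpa using hx
  have key : f q = α * f q + β * f q := by rw [← add_mul, hαβ, one_mul]
  rcases hx with hx | ⟨rfl, hP⟩
  · have hy' : f q ≤ f y := by
      rcases hy with hy | ⟨rfl, -⟩
      exacts [hy.le, le_rfl]
    left
    simp only [map_add, map_smul, smul_eq_mul]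
    nlinarith [mul_lt_mul_of_pos_left hx hα', mul_le_mul_of_nonneg_left hy' hβ]
  · rcases hy with hy | ⟨rfl, -⟩
    · left
      simp only [map_add, map_smul, smul_eq_mul]
      nlinarith [mul_lt_mul_of_pos_left hy hβ']
    · right
      exact ⟨by rw [← add_smul, hαβ, one_smul], hP⟩

lemma lt_or_eq_of_mem_convexHull {E : Type*} [AddCommGroup E] [Module ℝ E] {f : E →ₗ[ℝ] ℝ}
    {q : E} {S : Set E} (hS : ∀ s ∈ S, s ≠ q → f q < f s) {x : E} (hx : x ∈ convexHull ℝ S) :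
    f q < f x ∨ (x = q ∧ q ∈ S) := by
  refine convexHull_min (fun s hs => ?_) (convex_setOf_lt_or_eq f q (q ∈ S)) hx
  by_cases h : s = q
  · exact Or.inr ⟨h, h ▸ hs⟩
  · exact Or.inl (hS s hs h)

lemma notMem_convexHull_diff_of_exposed {E : Type*} [AddCommGroup E] [Module ℝ E] {f : E →ₗ[ℝ] ℝ}
    {q : E} {S : Set E} (hS : ∀ s ∈ S, s ≠ q → f q < f s) :
    q ∉ convexHull ℝ (convexHull ℝ S \ {q}) := by
  intro hq
  have : f q < f q :=
    convexHull_min (fun s hs => (lt_or_eq_of_mem_convexHull hS hs.1).resolve_right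
      fun h => hs.2 h.1) (convex_halfSpace_gt f.isLinear (f q)) hq
  exact this.false

/-- The linear functional `α x₂ + β xᵢ` on `ℝ³`. -/
noncomputable def coordCombination (i : Fin 3) (α β : ℝ) : EuclideanSpace ℝ (Fin 3) →ₗ[ℝ] ℝ :=
  α • (EuclideanSpace.proj 2 : EuclideanSpace ℝ (Fin 3) →L[ℝ] ℝ).toLinearMap +
    β • (EuclideanSpace.proj i : EuclideanSpace ℝ (Fin 3) →L[ℝ] ℝ).toLinearMap

@[simp]
lemma coordCombination_apply (i : Fin 3) (α β : ℝ) (x : EuclideanSpace ℝ (Fin 3)) :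
    coordCombination i α β x = α * x 2 + β * x i := by
  simp [coordCombination]

lemma coord_eq_of_mem_convexHull {i : Fin 3} {c : ℝ} {S : Set (EuclideanSpace ℝ (Fin 3))}
    (hS : ∀ s ∈ S, s i = c) {x : EuclideanSpace ℝ (Fin 3)} (hx : x ∈ convexHull ℝ S) :
    x i = c := by
  have := convexHull_min (t := {x | coordCombination i 0 1 x = c}) (fun s hs => by simp [hS s hs])
    (convex_hyperplane (coordCombination i 0 1).isLinear c) hx
  simpa using this

lemma coord_le_of_mem_convexHull {i : Fin 3} {c : ℝ} {S : Set (EuclideanSpace ℝ (Fin 3))}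
    (hS : ∀ s ∈ S, s i ≤ c) {x : EuclideanSpace ℝ (Fin 3)} (hx : x ∈ convexHull ℝ S) :
    x i ≤ c := by
  have := convexHull_min (t := {x | coordCombination i 0 1 x ≤ c}) (fun s hs => by simp [hS s hs])
    (convex_halfSpace_le (coordCombination i 0 1).isLinear c) hx
  simpa using this

lemma le_coord_of_mem_convexHull {i : Fin 3} {c : ℝ} {S : Set (EuclideanSpace ℝ (Fin 3))}
    (hS : ∀ s ∈ S, c ≤ s i) {x : EuclideanSpace ℝ (Fin 3)} (hx : x ∈ convexHull ℝ S) :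
    c ≤ x i := by
  have := convexHull_min (t := {x | c ≤ coordCombination i 0 1 x}) (fun s hs => by simp [hS s hs])
    (convex_halfSpace_ge (coordCombination i 0 1).isLinear c) hx
  simpa using this

lemma exists_plane_coord_eq (i : Fin 3) (c : ℝ) :
    ∃ W : AffineSubspace ℝ (EuclideanSpace ℝ (Fin 3)),
      Module.finrank ℝ W.direction = 2 ∧ ∀ x : EuclideanSpace ℝ (Fin 3), x i = c → x ∈ W := by
  let f : EuclideanSpace ℝ (Fin 3) →ₗ[ℝ] ℝ :=
    (EuclideanSpace.proj i : EuclideanSpace ℝ (Fin 3) →L[ℝ] ℝ).toLinearMap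
  have hf : ∀ x, f x = x i := fun x => rfl
  refine ⟨AffineSubspace.mk' (EuclideanSpace.single i c) (LinearMap.ker f), ?_, fun x hx => ?_⟩
  · rw [AffineSubspace.direction_mk']
    have hr : LinearMap.range f = ⊤ := LinearMap.range_eq_top.2 fun r =>
      ⟨EuclideanSpace.single i r, by simp [hf]⟩
    have := f.finrank_range_add_finrank_ker
    rw [hr, finrank_top, finrank_euclideanSpace_fin, Module.finrank_self] at this
    omega
  · rw [AffineSubspace.mem_mk']
    simp [LinearMap.mem_ker, hf, hx]

/-- The point of `ℝ³` at which the polygons of `a` and `b` touch, given the plane `x = x a` of `a`,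
the plane `y = y b` of `b` and the height `h a b`. -/
noncomputable def contactPoint {V : Type*} (x y : V → ℤ) (h : V → V → ℤ) (a b : V) :
    EuclideanSpace ℝ (Fin 3) :=
  !₂[(x a : ℝ), (y b : ℝ), (h a b : ℝ)]

section contactPoint

variable {V : Type*} (x y : V → ℤ) (h : V → V → ℤ) (a b : V)

@[simp] lemma contactPoint_zero : contactPoint x y h a b 0 = x a := rfl
@[simp] lemma contactPoint_one : contactPoint x y h a b 1 = y b := rfl
@[simp] lemma contactPoint_two : contactPoint x y h a b 2 = h a b := rfl

end contactPoint

/-- A bipartite graph has a contact representation with contact points `(x a, y b, h a b)` if the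
polygons of distinct vertices of `B` in the same plane are separated by height, and if `h` is
suitably strictly concave in `y` and strictly convex in `x`, up to a sign `σ b`. -/
lemma exists_contact_representation {V : Type*} (G : SimpleGraph V) (A B : Finset V)
    (hpart : ∀ v, (v ∈ A ∧ v ∉ B) ∨ (v ∈ B ∧ v ∉ A))
    (hbip : ∀ u v, G.Adj u v → (u ∈ A ∧ v ∈ B) ∨ (u ∈ B ∧ v ∈ A))
    (x y σ : V → ℤ) (h : V → V → ℤ) (d : ℤ)
    (hx : Set.InjOn x A) (hσ : ∀ b, σ b = 1 ∨ σ b = -1)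
    (hyσ : ∀ b ∈ B, ∀ b' ∈ B, y b = y b' → σ b = σ b' → b = b')
    (hup : ∀ a ∈ A, ∀ b ∈ B, σ b = 1 → d < h a b)
    (hlow : ∀ a ∈ A, ∀ b ∈ B, σ b = -1 → h a b ≤ d)
    (hconcave : ∀ a ∈ A, ∀ b ∈ B, ∀ b' ∈ B, b' ≠ b →
      -2 * σ b * h a b + -(2 * y b + 1) * y b < -2 * σ b * h a b' + -(2 * y b + 1) * y b')
    (hconvex : ∀ a ∈ A, ∀ b ∈ B, ∀ a' ∈ A, a' ≠ a →
      2 * σ b * h a b + -(2 * x a + 1) * x a < 2 * σ b * h a' b + -(2 * x a + 1) * x a') :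
    ∃ p : G.edgeSet → EuclideanSpace ℝ (Fin 3),
      Function.Injective p ∧
      (∀ e : G.edgeSet, ∃ a ∈ A, ∃ b ∈ B, p e = contactPoint x y h a b) ∧
      (∀ v : V, ∃ W : AffineSubspace ℝ (EuclideanSpace ℝ (Fin 3)),
        Module.finrank ℝ W.direction = 2 ∧
        {x | ∃ e : G.edgeSet, v ∈ (e : Sym2 V) ∧ x = p e} ⊆ (W : Set (EuclideanSpace ℝ (Fin 3)))) ∧
      (∀ (v : V) (e : G.edgeSet), v ∈ (e : Sym2 V) →
        p e ∉ convexHull ℝ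
          ((convexHull ℝ {x | ∃ e' : G.edgeSet, v ∈ (e' : Sym2 V) ∧ x = p e'}) \ {p e})) ∧
      (∀ u v (huv : G.Adj u v),
        convexHull ℝ {x | ∃ e : G.edgeSet, u ∈ (e : Sym2 V) ∧ x = p e} ∩
          convexHull ℝ {x | ∃ e : G.edgeSet, v ∈ (e : Sym2 V) ∧ x = p e} =
          {p ⟨s(u, v), G.mem_edgeSet.mpr huv⟩}) ∧
      (∀ u v, u ≠ v → ¬ G.Adj u v →
        convexHull ℝ {x | ∃ e : G.edgeSet, u ∈ (e : Sym2 V) ∧ x = p e} ∩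
          convexHull ℝ {x | ∃ e : G.edgeSet, v ∈ (e : Sym2 V) ∧ x = p e} = ∅) := by
  have hdisj : ∀ v ∈ A, v ∉ B := fun v hA hB => by
    rcases hpart v with h | h
    exacts [h.2 hB, h.2 hA]
  have hends : ∀ e : G.edgeSet, ∃ a b, a ∈ A ∧ b ∈ B ∧ G.Adj a b ∧ (e : Sym2 V) = s(a, b) := by
    rintro ⟨e, he⟩
    induction e using Sym2.ind with
    | _ u v =>
      have huv := G.mem_edgeSet.1 he
      rcases hbip u v huv with ⟨hu, hv⟩ | ⟨hu, hv⟩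
      · exact ⟨u, v, hu, hv, huv, rfl⟩
      · exact ⟨v, u, hv, hu, huv.symm, Sym2.eq_swap⟩
  choose α β hαA hβB hαβ he using hends
  set q := contactPoint x y h with hq
  have hqinj : ∀ a ∈ A, ∀ b ∈ B, ∀ a' ∈ A, ∀ b' ∈ B, q a b = q a' b' → a = a' ∧ b = b' := by
    intro a ha b hb a' ha' b' hb' hab
    have h0 : x a = x a' := by simpa [hq] using congrArg (fun w => w 0) hab
    have h1 : y b = y b' := by simpa [hq] using congrArg (fun w => w 1) hab
    have h2 : h a b = h a' b' := by simpa [hq] using congrArg (fun w => w 2) hab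
    obtain rfl := hx ha ha' h0
    refine ⟨rfl, by_contra fun hne => ?_⟩
    have := hconcave a ha b hb b' hb' (Ne.symm hne)
    rw [h2, h1] at this
    exact this.false
  let p : G.edgeSet → EuclideanSpace ℝ (Fin 3) := fun e => q (α e) (β e)
  have hαmem : ∀ (e : G.edgeSet), ∀ v ∈ A, v ∈ (e : Sym2 V) → α e = v := by
    intro e v hv hve
    rw [he e, Sym2.mem_iff] at hve
    rcases hve with h | h
    · exact h.symm
    · exact absurd (hβB e) (h ▸ hdisj v hv)
  have hβmem : ∀ (e : G.edgeSet), ∀ v ∈ B, v ∈ (e : Sym2 V) → β e = v := by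
    intro e v hv hve
    rw [he e, Sym2.mem_iff] at hve
    rcases hve with h | h
    · exact absurd hv (h ▸ hdisj _ (hαA e))
    · exact h.symm
  have hpadj : ∀ a ∈ A, ∀ b ∈ B, ∀ hab : s(a, b) ∈ G.edgeSet, p ⟨s(a, b), hab⟩ = q a b := by
    intro a ha b hb hab
    simp only [p]
    rw [hαmem ⟨s(a, b), hab⟩ a ha (Sym2.mem_mk_left a b),
      hβmem ⟨s(a, b), hab⟩ b hb (Sym2.mem_mk_right a b)]
  let S : V → Set (EuclideanSpace ℝ (Fin 3)) :=
    fun v => {x | ∃ e : G.edgeSet, v ∈ (e : Sym2 V) ∧ x = p e}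
  have hSA : ∀ a ∈ A, ∀ w ∈ S a, ∃ b ∈ B, G.Adj a b ∧ w = q a b := by
    rintro a ha w ⟨e, hae, rfl⟩
    obtain rfl := hαmem e a ha hae
    exact ⟨β e, hβB e, hαβ e, rfl⟩
  have hSB : ∀ b ∈ B, ∀ w ∈ S b, ∃ a ∈ A, G.Adj a b ∧ w = q a b := by
    rintro b hb w ⟨e, hbe, rfl⟩
    obtain rfl := hβmem e b hb hbe
    exact ⟨α e, hαA e, hαβ e, rfl⟩
  have hexpA : ∀ a ∈ A, ∀ b ∈ B, ∀ w ∈ S a, w ≠ q a b →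
      coordCombination 1 (-2 * σ b) (-(2 * y b + 1)) (q a b) <
        coordCombination 1 (-2 * σ b) (-(2 * y b + 1)) w := by
    intro a ha b hb w hw hne
    obtain ⟨b', hb', -, rfl⟩ := hSA a ha w hw
    have := hconcave a ha b hb b' hb' (fun h => hne (h ▸ rfl))
    simp only [coordCombination_apply, hq, contactPoint_one, contactPoint_two]
    exact_mod_cast this
  have hexpB : ∀ a ∈ A, ∀ b ∈ B, ∀ w ∈ S b, w ≠ q a b →
      coordCombination 0 (2 * σ b) (-(2 * x a + 1)) (q a b) <
        coordCombination 0 (2 * σ b) (-(2 * x a + 1)) w := by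
    intro a ha b hb w hw hne
    obtain ⟨a', ha', -, rfl⟩ := hSB b hb w hw
    have := hconvex a ha b hb a' ha' (fun h => hne (h ▸ rfl))
    simp only [coordCombination_apply, hq, contactPoint_zero, contactPoint_two]
    exact_mod_cast this
  have hx_hull : ∀ a ∈ A, ∀ w ∈ convexHull ℝ (S a), w 0 = x a := fun a ha w hw =>
    coord_eq_of_mem_convexHull (fun s hs => by
      obtain ⟨b, -, -, rfl⟩ := hSA a ha s hs
      simp [hq]) hw
  have hy_hull : ∀ b ∈ B, ∀ w ∈ convexHull ℝ (S b), w 1 = y b := fun b hb w hw =>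
    coord_eq_of_mem_convexHull (fun s hs => by
      obtain ⟨a, -, -, rfl⟩ := hSB b hb s hs
      simp [hq]) hw
  have hAB : ∀ a ∈ A, ∀ b ∈ B, ∀ w ∈ convexHull ℝ (S a), w ∈ convexHull ℝ (S b) →
      w = q a b ∧ G.Adj a b := by
    intro a ha b hb w hwa hwb
    have h0 := hx_hull a ha w hwa
    have h1 := hy_hull b hb w hwb
    rcases lt_or_eq_of_mem_convexHull (hexpA a ha b hb) hwa with hlt | ⟨rfl, hmem⟩
    · rcases lt_or_eq_of_mem_convexHull (hexpB a ha b hb) hwb with hlt' | ⟨rfl, -⟩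
      · simp only [coordCombination_apply, hq, contactPoint_zero, contactPoint_one,
          contactPoint_two, h0, h1] at hlt hlt'
        linarith
      · exact absurd hlt (lt_irrefl _)
    · obtain ⟨b', hb', hadj, heq⟩ := hSA a ha _ hmem
      obtain ⟨-, rfl⟩ := hqinj a ha b hb a ha b' hb' heq
      exact ⟨rfl, hadj⟩
  have hABadj : ∀ a ∈ A, ∀ b ∈ B, G.Adj a b →
      convexHull ℝ (S a) ∩ convexHull ℝ (S b) = {q a b} := by
    intro a ha b hb hab
    refine Set.Subset.antisymm (fun w hw => (hAB a ha b hb w hw.1 hw.2).1) ?_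
    rintro _ rfl
    have hp := (hpadj a ha b hb (G.mem_edgeSet.2 hab)).symm
    exact ⟨subset_convexHull ℝ _ ⟨_, Sym2.mem_mk_left a b, hp⟩,
      subset_convexHull ℝ _ ⟨_, Sym2.mem_mk_right a b, hp⟩⟩
  have hsep : ∀ b ∈ B, ∀ b' ∈ B, σ b = 1 → σ b' = -1 →
      ∀ w ∈ convexHull ℝ (S b), w ∉ convexHull ℝ (S b') := by
    intro b hb b' hb' h1 h2 w hw hw'
    have hle : w 2 ≤ (d : ℝ) := coord_le_of_mem_convexHull (fun s hs => by
      obtain ⟨a, ha, -, rfl⟩ := hSB b' hb' s hs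
      simpa [hq] using hlow a ha b' hb' h2) hw'
    have hge : ((d + 1 : ℤ) : ℝ) ≤ w 2 := le_coord_of_mem_convexHull (fun s hs => by
      obtain ⟨a, ha, -, rfl⟩ := hSB b hb s hs
      simp only [hq, contactPoint_two]
      exact_mod_cast hup a ha b hb h1) hw
    push_cast at hge
    linarith
  refine ⟨p, fun e e' hee => ?_, fun e => ⟨α e, hαA e, β e, hβB e, rfl⟩, fun v => ?_,
    fun v e hve => ?_, fun u v huv => ?_, fun u v hne huv => ?_⟩
  · obtain ⟨h1, h2⟩ := hqinj _ (hαA e) _ (hβB e) _ (hαA e') _ (hβB e') hee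
    exact Subtype.ext (by rw [he e, he e', h1, h2])
  · rcases hpart v with ⟨hv, -⟩ | ⟨hv, -⟩
    · obtain ⟨W, hW, hWx⟩ := exists_plane_coord_eq 0 (x v)
      exact ⟨W, hW, fun w hw => hWx w (hx_hull v hv w (subset_convexHull ℝ _ hw))⟩
    · obtain ⟨W, hW, hWy⟩ := exists_plane_coord_eq 1 (y v)
      exact ⟨W, hW, fun w hw => hWy w (hy_hull v hv w (subset_convexHull ℝ _ hw))⟩
  · rcases hpart v with ⟨hv, -⟩ | ⟨hv, -⟩
    · obtain rfl := hαmem e v hv hve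
      exact notMem_convexHull_diff_of_exposed (hexpA _ hv _ (hβB e))
    · obtain rfl := hβmem e v hv hve
      exact notMem_convexHull_diff_of_exposed (hexpB _ (hαA e) _ hv)
  · rcases hbip u v huv with ⟨hu, hv⟩ | ⟨hu, hv⟩
    · rw [hpadj u hu v hv]
      exact hABadj u hu v hv huv
    · have hswap : (⟨s(u, v), G.mem_edgeSet.mpr huv⟩ : G.edgeSet) =
          ⟨s(v, u), G.mem_edgeSet.mpr huv.symm⟩ := Subtype.ext Sym2.eq_swap
      rw [hswap, hpadj v hv u hu, Set.inter_comm]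
      exact hABadj v hv u hu huv.symm
  · refine Set.eq_empty_iff_forall_notMem.2 fun w ⟨hwu, hwv⟩ => ?_
    rcases hpart u with ⟨hu, -⟩ | ⟨hu, -⟩ <;> rcases hpart v with ⟨hv, -⟩ | ⟨hv, -⟩
    · have := (hx_hull u hu w hwu).symm.trans (hx_hull v hv w hwv)
      exact hne (hx hu hv (Int.cast_injective (α := ℝ) this))
    · exact huv (hAB u hu v hv w hwu hwv).2
    · exact huv (hAB v hv u hu w hwv hwu).2.symm
    · have hy : y u = y v := Int.cast_injective (α := ℝ)
        ((hy_hull u hu w hwu).symm.trans (hy_hull v hv w hwv))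
      rcases hσ u with h1 | h1 <;> rcases hσ v with h2 | h2
      · exact hne (hyσ u hu v hv hy (h1.trans h2.symm))
      · exact hsep u hu v hv h1 h2 w hwu hwv
      · exact hsep v hv u hu h2 h1 w hwv hwu
      · exact hne (hyσ u hu v hv hy (h1.trans h2.symm))

lemma Finset.exists_injOn_lt_card {V : Type*} [DecidableEq V] (A : Finset V) :
    ∃ f : V → ℤ, Set.InjOn f A ∧ ∀ v ∈ A, 0 ≤ f v ∧ f v < A.card := by
  refine ⟨fun v => if hv : v ∈ A then (A.equivFin ⟨v, hv⟩ : ℕ) else 0, ?_, ?_⟩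
  · intro u hu v hv huv
    have hu' : u ∈ A := hu
    have hv' : v ∈ A := hv
    simpa [hu', hv', Fin.val_inj] using huv
  · intro v hv
    simp [hv]

/-- Over an integer interval `[-n, n)`, the doubled triangular numbers `t * (t + 1)` range between
`0` and `(n - 1) * n`. -/
lemma mul_add_one_bounds {n t : ℤ} (h1 : -n ≤ t) (h2 : t < n) :
    0 ≤ t * (t + 1) ∧ t * (t + 1) ≤ (n - 1) * n := by
  constructor
  · rcases le_or_gt 0 t with h | h <;> nlinarith
  · nlinarith


/-- Every finite bipartite simple graph with parts `A` and `B` admits a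
contact representation by convex polygons in ℝ³ (polygons of low-degree vertices may
degenerate) whose contact points lie on an integer grid of size
`|A| × 2⌈|B|/4⌉ × (⌈|A|/2⌉² + ⌈|B|/4⌉²)`. -/
theorem bipartite_contact_representation_on_grid
    {V : Type*} [Fintype V] [DecidableEq V] (G : SimpleGraph V)
    (A B : Finset V)
    (hpart : ∀ v, (v ∈ A ∧ v ∉ B) ∨ (v ∈ B ∧ v ∉ A))
    (hbip : ∀ u v, G.Adj u v → (u ∈ A ∧ v ∈ B) ∨ (u ∈ B ∧ v ∈ A)) :
    ∃ (p : G.edgeSet → EuclideanSpace ℝ (Fin 3)) (x0 y0 z0 : ℤ),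
      Function.Injective p ∧
      -- all contact points lie on the integer grid of the prescribed size
      (∀ e : G.edgeSet, ∃ a b c : ℤ,
        p e 0 = (a : ℝ) ∧ p e 1 = (b : ℝ) ∧ p e 2 = (c : ℝ) ∧
        x0 ≤ a ∧ a < x0 + (A.card : ℤ) ∧
        y0 ≤ b ∧ b < y0 + (2 * ((B.card + 3) / 4) : ℕ) ∧
        z0 ≤ c ∧ c < z0 + ((((A.card + 1) / 2) ^ 2 + ((B.card + 3) / 4) ^ 2 : ℕ))) ∧
      -- each P v is contained in a 2-dimensional affine subspace
      (∀ v : V, ∃ W : AffineSubspace ℝ (EuclideanSpace ℝ (Fin 3)),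
        Module.finrank ℝ W.direction = 2 ∧
        {x | ∃ e : G.edgeSet, v ∈ (e : Sym2 V) ∧ x = p e} ⊆ (W : Set (EuclideanSpace ℝ (Fin 3)))) ∧
      -- each incident contact point is an extreme point of P v
      (∀ (v : V) (e : G.edgeSet), v ∈ (e : Sym2 V) →
        p e ∉ convexHull ℝ
          ((convexHull ℝ {x | ∃ e' : G.edgeSet, v ∈ (e' : Sym2 V) ∧ x = p e'}) \ {p e})) ∧
      -- polygons of adjacent vertices meet exactly in the contact point of their edge
      (∀ u v (huv : G.Adj u v),
        convexHull ℝ {x | ∃ e : G.edgeSet, u ∈ (e : Sym2 V) ∧ x = p e} ∩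
          convexHull ℝ {x | ∃ e : G.edgeSet, v ∈ (e : Sym2 V) ∧ x = p e} =
          {p ⟨s(u, v), G.mem_edgeSet.mpr huv⟩}) ∧
      -- polygons of distinct non-adjacent vertices are disjoint
      (∀ u v, u ≠ v → ¬ G.Adj u v →
        convexHull ℝ {x | ∃ e : G.edgeSet, u ∈ (e : Sym2 V) ∧ x = p e} ∩
          convexHull ℝ {x | ∃ e : G.edgeSet, v ∈ (e : Sym2 V) ∧ x = p e} = ∅) := by
  obtain ⟨T, hT⟩ : ∃ T : ℤ → ℤ, ∀ t, 2 * T t = t * (t + 1) :=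
    ⟨fun t => t * (t + 1) / 2, fun t => Int.mul_ediv_cancel' (Int.even_mul_succ_self t).two_dvd⟩
  obtain ⟨f, hf, hfA⟩ := A.exists_injOn_lt_card
  obtain ⟨g, hg, hgB⟩ := B.exists_injOn_lt_card
  obtain ⟨X, hX⟩ : ∃ X : ℤ, X = ((A.card + 1) / 2 : ℕ) := ⟨_, rfl⟩
  obtain ⟨Y, hY⟩ : ∃ Y : ℤ, Y = ((B.card + 3) / 4 : ℕ) := ⟨_, rfl⟩
  have hTbd : ∀ n t : ℤ, -n ≤ t → t < n → 0 ≤ T t ∧ T t ≤ T (n - 1) := by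
    intro n t h1 h2
    have := mul_add_one_bounds h1 h2
    have e := hT (n - 1)
    rw [sub_add_cancel] at e
    rw [← hT, ← e] at this
    omega
  let x : V → ℤ := fun v => f v - X
  let y : V → ℤ := fun v => g v / 2 - Y
  let σ : V → ℤ := fun v => 1 - 2 * (g v % 2)
  let h : V → V → ℤ := fun a b =>
    if σ b = 1 then T (x a) - T (y b) else T (y b) - T (x a) - 2 * T (Y - 1) - 1
  have hσ : ∀ b, σ b = 1 ∨ σ b = -1 := fun b => by simp only [σ]; omega
  have hσne : (-1 : ℤ) ≠ 1 := by decide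
  have hxbd : ∀ a ∈ A, -X ≤ x a ∧ x a < X := fun a ha => by
    have := hfA a ha
    simp only [x]; omega
  have hybd : ∀ b ∈ B, -Y ≤ y b ∧ y b < Y := fun b hb => by
    have := hgB b hb
    simp only [y]; omega
  have hTx : ∀ a ∈ A, 0 ≤ T (x a) ∧ T (x a) ≤ T (X - 1) := fun a ha =>
    hTbd X _ (hxbd a ha).1 (hxbd a ha).2
  have hTy : ∀ b ∈ B, 0 ≤ T (y b) ∧ T (y b) ≤ T (Y - 1) := fun b hb =>
    hTbd Y _ (hybd b hb).1 (hybd b hb).2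
  have hxinj : Set.InjOn x A := fun u hu v hv huv => hf hu hv (by simpa [x] using huv)
  have hyσ : ∀ b ∈ B, ∀ b' ∈ B, y b = y b' → σ b = σ b' → b = b' := by
    intro b hb b' hb' h1 h2
    refine hg hb hb' ?_
    simp only [y, σ] at h1 h2
    omega
  have hhup : ∀ a b, σ b = 1 → h a b = T (x a) - T (y b) := fun a b hb => if_pos hb
  have hhlow : ∀ a b, σ b = -1 → h a b = T (y b) - T (x a) - 2 * T (Y - 1) - 1 :=
    fun a b hb => if_neg (hb ▸ hσne)
  have hup : ∀ a ∈ A, ∀ b ∈ B, σ b = 1 → -T (Y - 1) - 1 < h a b := by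
    intro a ha b hb hs
    have h3 := hTx a ha
    have h4 := hTy b hb
    rw [hhup a b hs]; omega
  have hlow : ∀ a ∈ A, ∀ b ∈ B, σ b = -1 → h a b ≤ -T (Y - 1) - 1 := by
    intro a ha b hb hs
    have h3 := hTx a ha
    have h4 := hTy b hb
    rw [hhlow a b hs]; omega
  have hconcave : ∀ a ∈ A, ∀ b ∈ B, ∀ b' ∈ B, b' ≠ b →
      -2 * σ b * h a b + -(2 * y b + 1) * y b < -2 * σ b * h a b' + -(2 * y b + 1) * y b' := by
    intro a ha b hb b' hb' hne
    have h3 := hTx a ha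
    have h4 := hTy b hb
    have h5 := hTy b' hb'
    have e1 := hT (y b)
    have e2 := hT (y b')
    rcases hσ b with hs | hs <;> rcases hσ b' with hs' | hs'
    · have : y b' - y b ≠ 0 := fun h0 => hne (hyσ b' hb' b hb (by omega) (by omega))
      rw [hhup a b hs, hhup a b' hs', hs]
      nlinarith [sq_pos_of_ne_zero this]
    · rw [hhup a b hs, hhlow a b' hs', hs]
      nlinarith [sq_nonneg (y b' - y b)]
    · rw [hhlow a b hs, hhup a b' hs', hs]
      nlinarith [sq_nonneg (y b' - y b)]
    · have : y b' - y b ≠ 0 := fun h0 => hne (hyσ b' hb' b hb (by omega) (by omega))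
      rw [hhlow a b hs, hhlow a b' hs', hs]
      nlinarith [sq_pos_of_ne_zero this]
  have hconvex : ∀ a ∈ A, ∀ b ∈ B, ∀ a' ∈ A, a' ≠ a →
      2 * σ b * h a b + -(2 * x a + 1) * x a < 2 * σ b * h a' b + -(2 * x a + 1) * x a' := by
    intro a ha b hb a' ha' hne
    have e1 := hT (x a)
    have e2 := hT (x a')
    have : x a' - x a ≠ 0 := fun h0 => hne (hxinj ha' ha (by omega))
    rcases hσ b with hs | hs
    · rw [hhup a b hs, hhup a' b hs, hs]
      nlinarith [sq_pos_of_ne_zero this]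
    · rw [hhlow a b hs, hhlow a' b hs, hs]
      nlinarith [sq_pos_of_ne_zero this]
  obtain ⟨p, hp, hgrid, hrest⟩ := exists_contact_representation G A B hpart hbip x y σ h
    (-T (Y - 1) - 1) hxinj hσ hyσ hup hlow hconcave hconvex
  refine ⟨p, -X, -Y, -T (X - 1) - 2 * T (Y - 1) - 1, hp, fun e => ?_, hrest⟩
  obtain ⟨a, ha, b, hb, hpe⟩ := hgrid e
  have hXA := hfA a ha
  have hYB := hgB b hb
  have h1 := hxbd a ha
  have h2 := hybd b hb
  have h3 := hTx a ha
  have h4 := hTy b hb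
  refine ⟨x a, y b, h a b, by simp [hpe], by simp [hpe], by simp [hpe], h1.1, ?_, h2.1, ?_, ?_, ?_⟩
  · simp only [x]; omega
  · push_cast at hY ⊢
    omega
  · rcases hσ b with hs | hs
    · rw [hhup a b hs]; omega
    · rw [hhlow a b hs]; omega
  · push_cast at hX hY ⊢
    rw [← hX, ← hY]
    have eX := hT (X - 1)
    have eY := hT (Y - 1)
    have hXY : 2 * T (X - 1) + 2 * T (Y - 1) + 1 < X ^ 2 + Y ^ 2 := by
      rw [eX, eY]
      nlinarith
    rcases hσ b with hs | hs
    · rw [hhup a b hs]; linarith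
    · rw [hhlow a b hs]; linarith
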